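/- arXiv:math/0001083 — 3 statements merged into one kernel-verified Lean document; each statement's English description precedes it below -/
import Mathlib

section
/- An ℝ-linear map A : ℍ → ℍ on the quaternions is skew-adjoint with respect to the inner product ⟪p,q⟫ = Re(p * conj q) if and only if there exist pure imaginary quaternions a and b with A = L_a + R_b, i.e. A(z) = a*z + z*b for all z ∈ ℍ; moreover, such a and b are uniquely determined by A. -/
open Quaternion

/-- An ℝ-linear endomorphism of the quaternions is skew-adjoint for the real inner
product `⟪p,q⟫ = Re (p * conj q)`. -/
def SkewH (A : ℍ[ℝ] →ₗ[ℝ] ℍ[ℝ]) : Prop :=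
  ∀ p q : ℍ[ℝ], (A p * star q).re + (p * star (A q)).re = 0

/-- The quaternion with given coordinates. -/
def mkQ (a b c d : ℝ) : ℍ[ℝ] := ⟨a, b, c, d⟩

@[simp] theorem mkQ_re (a b c d : ℝ) : (mkQ a b c d).re = a := rfl
@[simp] theorem mkQ_imI (a b c d : ℝ) : (mkQ a b c d).imI = b := rfl
@[simp] theorem mkQ_imJ (a b c d : ℝ) : (mkQ a b c d).imJ = c := rfl
@[simp] theorem mkQ_imK (a b c d : ℝ) : (mkQ a b c d).imK = d := rfl

/-- An ℝ-linear map `A : ℍ → ℍ` is skew-adjoint iff there is a unique pair `(a,b)` of pure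
imaginary quaternions with `A = L_a + R_b`, i.e. `A z = a*z + z*b`. -/
theorem statement1 (A : ℍ[ℝ] →ₗ[ℝ] ℍ[ℝ]) :
    SkewH A ↔
      ∃! ab : ℍ[ℝ] × ℍ[ℝ], ab.1.re = 0 ∧ ab.2.re = 0 ∧
        ∀ z : ℍ[ℝ], A z = ab.1 * z + z * ab.2 := by
  constructor
  · intro h
    have hz : ∀ z : ℍ[ℝ], A z = z.re • A (mkQ 1 0 0 0) + z.imI • A (mkQ 0 1 0 0)
        + z.imJ • A (mkQ 0 0 1 0) + z.imK • A (mkQ 0 0 0 1) := by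
      intro z
      rw [← A.map_smul, ← A.map_smul, ← A.map_smul, ← A.map_smul, ← map_add, ← map_add, ← map_add]
      congr 1
      ext <;> simp
    have h00 := h (mkQ 1 0 0 0) (mkQ 1 0 0 0)
    have h01 := h (mkQ 1 0 0 0) (mkQ 0 1 0 0)
    have h02 := h (mkQ 1 0 0 0) (mkQ 0 0 1 0)
    have h03 := h (mkQ 1 0 0 0) (mkQ 0 0 0 1)
    have h11 := h (mkQ 0 1 0 0) (mkQ 0 1 0 0)
    have h12 := h (mkQ 0 1 0 0) (mkQ 0 0 1 0)
    have h13 := h (mkQ 0 1 0 0) (mkQ 0 0 0 1)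
    have h22 := h (mkQ 0 0 1 0) (mkQ 0 0 1 0)
    have h23 := h (mkQ 0 0 1 0) (mkQ 0 0 0 1)
    have h33 := h (mkQ 0 0 0 1) (mkQ 0 0 0 1)
    generalize A (mkQ 1 0 0 0) = u at *
    generalize A (mkQ 0 1 0 0) = v at *
    generalize A (mkQ 0 0 1 0) = w at *
    generalize A (mkQ 0 0 0 1) = x at *
    simp at h00 h01 h02 h03 h11 h12 h13 h22 h23 h33
    refine ⟨(mkQ 0 ((u.imI + w.imK)/2) ((u.imJ - v.imK)/2) ((u.imK + v.imJ)/2),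
      mkQ 0 ((u.imI - w.imK)/2) ((u.imJ + v.imK)/2) ((u.imK - v.imJ)/2)), ⟨rfl, rfl, ?_⟩, ?_⟩
    · intro z
      rw [hz]
      clear hz h
      ext <;> simp <;> grind
    · rintro ⟨a, b⟩ ⟨ha, hb, hab⟩
      simp only at ha hb hab
      have e : ∀ z : ℍ[ℝ], _ := fun z => (hz z).symm.trans (hab z)
      have e0 := e (mkQ 1 0 0 0)
      have e1 := e (mkQ 0 1 0 0)
      have e2 := e (mkQ 0 0 1 0)
      simp [Quaternion.ext_iff] at e0 e1 e2
      rw [Prod.mk.injEq]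
      clear hz h hab e
      constructor <;> ext <;> simp <;> grind
  · rintro ⟨⟨a, b⟩, ⟨ha, hb, hab⟩, -⟩ p q
    simp only at ha hb hab
    rw [hab, hab]
    simp [ha, hb]
    ring
end

section
/- Let K be a real composition algebra. For any x,y ∈ K, the triple T_{x,y} := (4·S_{x,y}, R_y∘R_{x̄} − R_x∘R_{ȳ}, L_y∘L_{x̄} − L_x∘L_{ȳ}) belongs to the triality algebra Tri K, where S_{x,y} is the ℝ-linear map S_{x,y}(z) = ⟨x,z⟩·y − ⟨y,z⟩·x. -/
/-! Basic notions for a real composition algebra `K`, presented via the symmetric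
bilinear form `Bf` obtained by polarizing the multiplicative quadratic form
(`N x = Bf x x` and `⟨x,y⟩ = Bf x y`). -/

variable {K : Type*} [NonAssocRing K] [Module ℝ K]
  [SMulCommClass ℝ K K] [IsScalarTower ℝ K K]

/-- `Bf` is the polarization (with the factor 1/2) of a multiplicative nondegenerate
quadratic form on the finite-dimensional real algebra `K`; this is the data of a real
composition algebra. -/
structure IsCompAlg (Bf : K →ₗ[ℝ] K →ₗ[ℝ] ℝ) : Prop where
  symm : ∀ x y : K, Bf x y = Bf y x
  nondeg : ∀ x : K, (∀ y : K, Bf x y = 0) → x = 0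
  comp : ∀ x y : K, Bf (x * y) (x * y) = Bf x x * Bf y y

/-- The conjugation `x ↦ 2⟨x,1⟩·1 - x` of a composition algebra. -/
def conjK (Bf : K →ₗ[ℝ] K →ₗ[ℝ] ℝ) (x : K) : K := (2 * Bf x 1) • (1 : K) - x

/-- Left multiplication `L_a` as a real-linear map. -/
def Lm (a : K) : K →ₗ[ℝ] K := LinearMap.mulLeft ℝ a

/-- Right multiplication `R_a` as a real-linear map. -/
def Rm (a : K) : K →ₗ[ℝ] K := LinearMap.mulRight ℝ a

/-- A real-linear endomorphism of `K` lies in `𝔰𝔬(K)`. -/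
def Skw (Bf : K →ₗ[ℝ] K →ₗ[ℝ] ℝ) (A : K →ₗ[ℝ] K) : Prop :=
  ∀ x y : K, Bf (A x) y + Bf x (A y) = 0

/-- Membership in the triality algebra `Tri K ⊆ 𝔰𝔬(K)³`. -/
def InTri (Bf : K →ₗ[ℝ] K →ₗ[ℝ] ℝ)
    (T : (K →ₗ[ℝ] K) × (K →ₗ[ℝ] K) × (K →ₗ[ℝ] K)) : Prop :=
  Skw Bf T.1 ∧ Skw Bf T.2.1 ∧ Skw Bf T.2.2 ∧
    ∀ x y : K, T.1 (x * y) = x * T.2.1 y + T.2.2 x * y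

/-- A derivation of the algebra `K`. -/
def IsDerK (D : K →ₗ[ℝ] K) : Prop := ∀ x y : K, D (x * y) = D x * y + x * D y

section Helpers

variable {Bf : K →ₗ[ℝ] K →ₗ[ℝ] ℝ}

theorem hp_ext (h : IsCompAlg Bf) {a b : K} (H : ∀ c, Bf a c = Bf b c) : a = b := by
  rw [← sub_eq_zero]
  apply h.nondeg
  intro c
  simp [H c]

theorem hp_left (h : IsCompAlg Bf) (a b c : K) : Bf (a * b) (a * c) = Bf a a * Bf b c := by
  have h1 := h.comp a (b + c)
  simp only [mul_add, map_add, LinearMap.add_apply] at h1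
  have h2 := h.comp a b
  have h3 := h.comp a c
  have h4 := h.symm (a * b) (a * c)
  have h5 := h.symm b c
  rw [h5] at h1 ⊢
  linarith

theorem hp_polar (h : IsCompAlg Bf) (a b c d : K) :
    Bf (a * b) (c * d) + Bf (a * d) (c * b) = 2 * Bf a c * Bf b d := by
  have h1 := hp_left h (a + c) b d
  simp only [add_mul, map_add, LinearMap.add_apply] at h1
  have h2 := hp_left h a b d
  have h3 := hp_left h c b d
  have h4 := h.symm (a * d) (c * b)
  have h5 := h.symm a c
  rw [h5] at h1 ⊢
  linarith

theorem hp_one (h : IsCompAlg Bf) (b c : K) : Bf (1 : K) 1 * Bf b c = Bf b c := by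
  have := hp_left h 1 b c
  simpa using this.symm

theorem hp_adjL (h : IsCompAlg Bf) (a b c : K) : Bf (a * b) c = Bf b (conjK Bf a * c) := by
  have h1 := hp_polar h a b 1 c
  simp only [one_mul] at h1
  simp only [conjK, sub_mul, smul_mul_assoc, one_mul, map_sub, map_smul, smul_eq_mul]
  rw [h.symm b (a * c)]
  linarith

theorem hp_adjR (h : IsCompAlg Bf) (a b c : K) : Bf (a * b) c = Bf a (c * conjK Bf b) := by
  have h1 := hp_polar h a b c 1
  simp only [mul_one] at h1
  simp only [conjK, mul_sub, mul_smul_comm, mul_one, map_sub, map_smul, smul_eq_mul]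
  linarith

theorem hp_cc (h : IsCompAlg Bf) (a : K) : conjK Bf (conjK Bf a) = a := by
  apply hp_ext h
  intro c
  have h1 := hp_one h a 1
  simp only [conjK, map_sub, map_smul, smul_eq_mul, LinearMap.sub_apply, LinearMap.smul_apply]
  linear_combination (4 * Bf (1 : K) c) * h1

theorem hp_ci (h : IsCompAlg Bf) (a b : K) : Bf (conjK Bf a) (conjK Bf b) = Bf a b := by
  have h1 := hp_one h a 1
  simp only [conjK, map_sub, map_smul, smul_eq_mul, LinearMap.sub_apply, LinearMap.smul_apply]
  rw [h.symm 1 b]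
  linear_combination (4 * Bf b 1) * h1

theorem hp_cm (h : IsCompAlg Bf) (a b : K) :
    conjK Bf (a * b) = conjK Bf b * conjK Bf a := by
  apply hp_ext h
  intro c
  calc Bf (conjK Bf (a * b)) c = Bf (a * b) (conjK Bf c) := by rw [← hp_ci h, hp_cc h]
    _ = Bf b (conjK Bf a * conjK Bf c) := hp_adjL h _ _ _
    _ = Bf (b * c) (conjK Bf a) := (hp_adjR h _ _ _).symm
    _ = Bf c (conjK Bf b * conjK Bf a) := hp_adjL h _ _ _
    _ = _ := h.symm _ _

theorem hp_altR (h : IsCompAlg Bf) (b x y : K) :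
    (b * conjK Bf x) * y + (b * conjK Bf y) * x = (2 * Bf x y) • b := by
  apply hp_ext h
  intro c
  have h1 := hp_polar h b (conjK Bf x) c (conjK Bf y)
  rw [hp_ci h] at h1
  simp only [map_add, map_smul, smul_eq_mul, LinearMap.add_apply, LinearMap.smul_apply]
  rw [hp_adjR h _ y, hp_adjR h _ x]
  linarith

theorem hp_altL (h : IsCompAlg Bf) (a x y : K) :
    y * (conjK Bf x * a) + x * (conjK Bf y * a) = (2 * Bf x y) • a := by
  apply hp_ext h
  intro c
  have h1 := hp_polar h (conjK Bf x) a (conjK Bf y) c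
  rw [hp_ci h] at h1
  simp only [map_add, map_smul, smul_eq_mul, LinearMap.add_apply, LinearMap.smul_apply]
  rw [hp_adjL h y, hp_adjL h x, h.symm (conjK Bf y * a)]
  linarith [h.symm (conjK Bf y * a) (conjK Bf x * c)]

theorem hp_main (h : IsCompAlg Bf) (a b x y : K) :
    a * ((b * conjK Bf x) * y) + (y * (conjK Bf x * a)) * b
      = (2 * Bf x (a * b)) • y - (2 * Bf y (a * b)) • x + (2 * Bf x y) • (a * b) := by
  apply hp_ext h
  intro c
  have e1 : Bf (a * ((b * conjK Bf x) * y)) c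
      = Bf ((b * conjK Bf x) * y) (conjK Bf a * c) := hp_adjL h _ _ _
  have e2 := hp_polar h (b * conjK Bf x) y (conjK Bf a) c
  have e3 : Bf (b * conjK Bf x) (conjK Bf a) = Bf x (a * b) := by
    rw [hp_adjR h, hp_cc h, ← hp_adjL h, h.symm]
  have e4 : Bf ((y * (conjK Bf x * a)) * b) c
      = Bf (conjK Bf a * x) ((b * conjK Bf c) * y) := by
    rw [hp_adjR h, hp_adjL h, ← hp_ci h]
    simp only [hp_cm h, hp_cc h]
  have e5 := congrArg (fun t => Bf t (conjK Bf a * y)) (hp_altR h b x c)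
  simp only [map_add, map_smul, smul_eq_mul, LinearMap.add_apply, LinearMap.smul_apply] at e5
  have e6 : Bf b (conjK Bf a * y) = Bf y (a * b) := by
    rw [← hp_adjL h, h.symm]
  have e7 := hp_polar h (b * conjK Bf c) x (conjK Bf a) y
  have e8 : Bf (b * conjK Bf c) (conjK Bf a) = Bf (a * b) c := by
    rw [hp_adjR h, hp_cc h, ← hp_adjL h]
  have e9 := h.symm (conjK Bf a * x) ((b * conjK Bf c) * y)
  simp only [map_add, map_sub, map_smul, smul_eq_mul, LinearMap.add_apply,
    LinearMap.sub_apply, LinearMap.smul_apply]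
  rw [e3] at e2
  rw [e6] at e5
  rw [e8] at e7
  linarith

end Helpers

/-- For any `x, y` in a real composition algebra `K`, the triple
`T_{x,y} = (4 S_{x,y}, R_y R_{x̄} - R_x R_{ȳ}, L_y L_{x̄} - L_x L_{ȳ})` belongs to
`Tri K`, where `S_{x,y} z = ⟨x,z⟩ y - ⟨y,z⟩ x`. -/
theorem statement4 [FiniteDimensional ℝ K]
    (Bf : K →ₗ[ℝ] K →ₗ[ℝ] ℝ) (hca : IsCompAlg Bf) (x y : K) :
    InTri Bf
      ((4 : ℝ) • ((Bf x).smulRight y - (Bf y).smulRight x),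
       Rm y ∘ₗ Rm (conjK Bf x) - Rm x ∘ₗ Rm (conjK Bf y),
       Lm y ∘ₗ Lm (conjK Bf x) - Lm x ∘ₗ Lm (conjK Bf y)) := by
  refine ⟨?_, ?_, ?_, ?_⟩
  · intro a b
    simp only [map_sub, map_smul, smul_eq_mul, LinearMap.sub_apply, LinearMap.smul_apply,
      LinearMap.smulRight_apply]
    rw [hca.symm a x, hca.symm a y]
    ring
  · intro a b
    simp only [Rm, map_sub, LinearMap.sub_apply, LinearMap.comp_apply,
      LinearMap.mulRight_apply]
    have h1 : ∀ u v : K, Bf (a * conjK Bf u * v) b = Bf a (b * conjK Bf v * u) := by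
      intro u v
      rw [hp_adjR hca, hp_adjR hca, hp_cc hca]
    rw [h1, h1]
    ring
  · intro a b
    simp only [Lm, map_sub, LinearMap.sub_apply, LinearMap.comp_apply,
      LinearMap.mulLeft_apply]
    have h1 : ∀ u v : K, Bf (v * (conjK Bf u * a)) b = Bf a (u * (conjK Bf v * b)) := by
      intro u v
      rw [hp_adjL hca, hp_adjL hca, hp_cc hca]
    rw [h1, h1]
    ring
  · intro a b
    simp only [Lm, Rm, LinearMap.sub_apply, LinearMap.smul_apply,
      LinearMap.smulRight_apply, LinearMap.comp_apply,
      LinearMap.mulLeft_apply, LinearMap.mulRight_apply]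
    have h1 := hp_main hca a b x y
    have h2 := hp_main hca a b y x
    rw [hca.symm y x] at h2
    rw [mul_sub, sub_mul]
    have h3 := congrArg₂ (· - ·) h1 h2
    calc _ = (2 * Bf x (a * b)) • y - (2 * Bf y (a * b)) • x + (2 * Bf x y) • (a * b)
          - ((2 * Bf y (a * b)) • x - (2 * Bf x (a * b)) • y + (2 * Bf x y) • (a * b)) := by
          module
      _ = _ := h3.symm
      _ = _ := by abel
end

section
/- Let K be a real composition algebra. Every derivation D of H₃(K) can be written in exactly one way in the form D(H) = X*H − H*X + Ê(H), where X is a 3×3 matrix over K with Xᴴ = −X and with trace zero (the sum of its diagonal entries is 0), and Ê acts entrywise by a derivation E ∈ Der K (i.e. Ê(H)_{ij} = E(H_{ij})). Conversely, for every such X and E the map H ↦ X*H − H*X + Ê(H) is a derivation of H₃(K). Thus Der H₃(K) = Der K ∔ A₃′(K) as vector spaces, where A₃′(K) is the space of traceless antihermitian 3×3 matrices over K. -/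
/-! Basic notions for a real composition algebra `K`, presented via the symmetric
bilinear form `Bf` obtained by polarizing the multiplicative quadratic form
(`N x = Bf x x` and `⟨x,y⟩ = Bf x y`). -/

variable {K : Type*} [NonAssocRing K] [Module ℝ K]
  [SMulCommClass ℝ K K] [IsScalarTower ℝ K K]

/-- Conjugate transpose of a 3×3 matrix over the composition algebra `K`. -/
def ctm (Bf : K →ₗ[ℝ] K →ₗ[ℝ] ℝ) (H : Matrix (Fin 3) (Fin 3) K) :
    Matrix (Fin 3) (Fin 3) K :=
  Matrix.of fun i j => conjK Bf (H j i)

/-- `H` is hermitian. -/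
def IsHerm (Bf : K →ₗ[ℝ] K →ₗ[ℝ] ℝ) (H : Matrix (Fin 3) (Fin 3) K) : Prop :=
  ctm Bf H = H

/-- `D` is a derivation of the Jordan algebra `H₃(K)`: it preserves hermitian matrices
and satisfies the Leibniz rule for the Jordan product `H∘K = HK + KH` of hermitian
matrices. -/
def IsDerH3 (Bf : K →ₗ[ℝ] K →ₗ[ℝ] ℝ)
    (D : Matrix (Fin 3) (Fin 3) K → Matrix (Fin 3) (Fin 3) K) : Prop :=
  (∀ H, IsHerm Bf H → IsHerm Bf (D H)) ∧
  ∀ H K', IsHerm Bf H → IsHerm Bf K' →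
    D (H * K' + K' * H) = D H * K' + K' * D H + H * D K' + D K' * H

section Aux

set_option linter.unusedSectionVars false
set_option linter.unusedSimpArgs false

theorem ca_polR {Bf : K →ₗ[ℝ] K →ₗ[ℝ] ℝ} (h : IsCompAlg Bf) (x y z : K) :
    Bf (x * y) (x * z) = Bf x x * Bf y z := by
  have h1 := h.comp x (y + z)
  simp only [mul_add, map_add, LinearMap.add_apply] at h1
  have h2 := h.comp x y
  have h3 := h.comp x z
  have h4 := h.symm (x * y) (x * z)
  have h5 := h.symm y z
  rw [← h4, ← h5] at h1
  linarith

theorem ca_polL {Bf : K →ₗ[ℝ] K →ₗ[ℝ] ℝ} (h : IsCompAlg Bf) (x y z : K) :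
    Bf (x * z) (y * z) = Bf x y * Bf z z := by
  have h1 := h.comp (x + y) z
  simp only [add_mul, map_add, LinearMap.add_apply] at h1
  have h2 := h.comp x z
  have h3 := h.comp y z
  have h4 := h.symm (x * z) (y * z)
  have h5 := h.symm x y
  rw [← h4, ← h5] at h1
  linarith

theorem ca_pol {Bf : K →ₗ[ℝ] K →ₗ[ℝ] ℝ} (h : IsCompAlg Bf) (x y z w : K) :
    Bf (x * y) (z * w) + Bf (z * y) (x * w) = 2 * (Bf x z * Bf y w) := by
  have h1 := ca_polR h (x + z) y w
  simp only [add_mul, map_add, LinearMap.add_apply] at h1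
  have h2 := ca_polR h x y w
  have h3 := ca_polR h z y w
  have h5 := h.symm x z
  rw [← h5] at h1
  linarith

theorem ca_one {Bf : K →ₗ[ℝ] K →ₗ[ℝ] ℝ} (h : IsCompAlg Bf) :
    Bf 1 1 = 1 ∨ ∀ x : K, x = 0 := by
  by_contra hc
  push Not at hc
  obtain ⟨h1, x, hx⟩ := hc
  have hN : ∀ y, Bf y y = 0 := by
    intro y
    have := h.comp y 1
    rw [mul_one] at this
    have h2 : Bf y y * (Bf 1 1 - 1) = 0 := by linarith
    rcases mul_eq_zero.1 h2 with h3 | h3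
    · exact h3
    · exact absurd (by linarith) h1
  apply hx
  apply h.nondeg
  intro y
  have := hN (x + y)
  simp only [map_add, LinearMap.add_apply] at this
  have h2 := hN x
  have h3 := hN y
  have h4 := h.symm x y
  linarith

theorem ca_ext {Bf : K →ₗ[ℝ] K →ₗ[ℝ] ℝ} (h : IsCompAlg Bf) {x y : K}
    (hh : ∀ z, Bf x z = Bf y z) : x = y := by
  have : x - y = 0 := h.nondeg _ fun z => by simp [hh z]
  exact sub_eq_zero.1 this

theorem ca_adjL {Bf : K →ₗ[ℝ] K →ₗ[ℝ] ℝ} (h : IsCompAlg Bf) (x y w : K) :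
    Bf (conjK Bf x * y) w = Bf y (x * w) := by
  have := ca_pol h x y 1 w
  simp only [one_mul] at this
  simp only [conjK, sub_mul, smul_mul_assoc, one_mul, map_sub, map_smul, LinearMap.sub_apply,
    LinearMap.smul_apply, smul_eq_mul]
  linarith

theorem ca_adjR {Bf : K →ₗ[ℝ] K →ₗ[ℝ] ℝ} (h : IsCompAlg Bf) (x y w : K) :
    Bf (y * conjK Bf x) w = Bf y (w * x) := by
  have h1 := ca_polL h y w (x + 1)
  have h2 := ca_polL h y w x
  have h3 := ca_polL h y w 1
  have h4 := h.symm x 1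
  simp only [mul_add, mul_one, map_add, LinearMap.add_apply] at h1 h2 h3
  rw [← h4] at h1
  simp only [conjK, mul_sub, mul_smul_comm, mul_one, map_sub, map_smul, LinearMap.sub_apply,
    LinearMap.smul_apply, smul_eq_mul]
  linarith

theorem ca_conj_one {Bf : K →ₗ[ℝ] K →ₗ[ℝ] ℝ} (h1 : Bf 1 1 = 1) :
    conjK Bf (1 : K) = 1 := by
  simp only [conjK, h1]; module

theorem ca_conj_conj {Bf : K →ₗ[ℝ] K →ₗ[ℝ] ℝ} (h1 : Bf 1 1 = 1) (x : K) :
    conjK Bf (conjK Bf x) = x := by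
  simp only [conjK, h1, map_sub, map_smul, LinearMap.sub_apply, LinearMap.smul_apply, smul_eq_mul]
  module

theorem ca_conj_add (Bf : K →ₗ[ℝ] K →ₗ[ℝ] ℝ) (x y : K) :
    conjK Bf (x + y) = conjK Bf x + conjK Bf y := by
  simp only [conjK, map_add, LinearMap.add_apply]
  module

theorem ca_conj_smul (Bf : K →ₗ[ℝ] K →ₗ[ℝ] ℝ) (t : ℝ) (x : K) :
    conjK Bf (t • x) = t • conjK Bf x := by
  simp only [conjK, map_smul, LinearMap.smul_apply, smul_eq_mul]
  module

theorem ca_conj_neg (Bf : K →ₗ[ℝ] K →ₗ[ℝ] ℝ) (x : K) :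
    conjK Bf (-x) = -conjK Bf x := by
  simp only [conjK, map_neg, LinearMap.neg_apply]
  module

theorem ca_conj_sub (Bf : K →ₗ[ℝ] K →ₗ[ℝ] ℝ) (x y : K) :
    conjK Bf (x - y) = conjK Bf x - conjK Bf y := by
  simp only [conjK, map_sub, LinearMap.sub_apply]
  module

theorem ca_conj_zero (Bf : K →ₗ[ℝ] K →ₗ[ℝ] ℝ) :
    conjK Bf (0 : K) = 0 := by
  simp [conjK]

theorem ca_conjL {Bf : K →ₗ[ℝ] K →ₗ[ℝ] ℝ} (h : IsCompAlg Bf) (x y : K) :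
    conjK Bf x * (x * y) = Bf x x • y := by
  apply ca_ext h
  intro z
  rw [ca_adjL h, ca_polR h]
  simp

theorem ca_conjR {Bf : K →ₗ[ℝ] K →ₗ[ℝ] ℝ} (h : IsCompAlg Bf) (x y : K) :
    (y * x) * conjK Bf x = Bf x x • y := by
  apply ca_ext h
  intro z
  rw [ca_adjR h, ca_polL h]
  simp [mul_comm]

theorem ca_sq {Bf : K →ₗ[ℝ] K →ₗ[ℝ] ℝ} (h : IsCompAlg Bf) (x : K) :
    x * x = (2 * Bf x 1) • x - Bf x x • 1 := by
  have := ca_conjL h x 1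
  simp only [conjK, mul_one, sub_mul, smul_mul_assoc, one_mul] at this
  rw [← this]; module

theorem ca_altL {Bf : K →ₗ[ℝ] K →ₗ[ℝ] ℝ} (h : IsCompAlg Bf) (x y : K) :
    (x * x) * y = x * (x * y) := by
  have := ca_conjL h x y
  simp only [conjK, sub_mul, smul_mul_assoc, one_mul] at this
  rw [ca_sq h, sub_mul, smul_mul_assoc, smul_mul_assoc, one_mul, ← this]; module

theorem ca_altR {Bf : K →ₗ[ℝ] K →ₗ[ℝ] ℝ} (h : IsCompAlg Bf) (x y : K) :
    (y * x) * x = y * (x * x) := by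
  have := ca_conjR h x y
  simp only [conjK, mul_sub, mul_smul_comm, mul_one] at this
  rw [ca_sq h, mul_sub, mul_smul_comm, mul_smul_comm, mul_one, ← this]; module

theorem ca_jord {Bf : K →ₗ[ℝ] K →ₗ[ℝ] ℝ} (h : IsCompAlg Bf) (x y : K) :
    x * y + y * x = (2 * Bf x 1) • y + (2 * Bf y 1) • x - (2 * Bf x y) • 1 := by
  have h1 := ca_sq h (x + y)
  have h2 := ca_sq h x
  have h3 := ca_sq h y
  have h4 := h.symm x y
  simp only [mul_add, add_mul, map_add, LinearMap.add_apply] at h1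
  rw [h2, h3, ← h4] at h1
  linear_combination (norm := module) h1

theorem ca_conj_mul {Bf : K →ₗ[ℝ] K →ₗ[ℝ] ℝ} (h : IsCompAlg Bf) (h1 : Bf 1 1 = 1) (x y : K) :
    conjK Bf (x * y) = conjK Bf y * conjK Bf x := by
  have h2 := ca_jord h x y
  have h3 := ca_adjL h (conjK Bf x) y 1
  rw [ca_conj_conj h1, mul_one] at h3
  have h4 : Bf (x * y) 1 = 2 * Bf x 1 * Bf y 1 - Bf x y := by
    rw [h3, h.symm x y]
    simp only [conjK, map_sub, map_smul, smul_eq_mul]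
  simp only [conjK, h4, mul_sub, sub_mul, smul_mul_assoc, mul_smul_comm, one_mul, mul_one]
  linear_combination (norm := module) -h2

theorem ca_real {Bf : K →ₗ[ℝ] K →ₗ[ℝ] ℝ} {x : K} (hx : conjK Bf x = x) :
    x = Bf x 1 • (1 : K) := by
  have h2 : (2 : ℝ) • x = (2 : ℝ) • (Bf x 1 • (1 : K)) := by
    unfold conjK at hx
    linear_combination (norm := module) -hx
  exact smul_right_injective K (two_ne_zero (α := ℝ)) h2

theorem der_one {E : K →ₗ[ℝ] K} (hE : IsDerK E) : E 1 = 0 := by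
  have := hE 1 1
  simpa using this

theorem der_conj {Bf : K →ₗ[ℝ] K →ₗ[ℝ] ℝ} (h : IsCompAlg Bf) {E : K →ₗ[ℝ] K}
    (hE : IsDerK E) (x : K) : E (conjK Bf x) = conjK Bf (E x) := by
  have key : Bf (E x) 1 = 0 := by
    have h1 := congrArg E (ca_sq h x)
    rw [hE, ca_jord h] at h1
    simp only [map_sub, map_smul, der_one hE] at h1
    have h2 : Bf (E x) 1 • x = Bf (E x) x • (1 : K) := by
      have h2 : (2 : ℝ) • (Bf (E x) 1 • x) = (2 : ℝ) • (Bf (E x) x • (1 : K)) := by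
        linear_combination (norm := module) h1
      exact smul_right_injective K (two_ne_zero (α := ℝ)) h2
    by_contra hc
    have h3 : x = ((Bf (E x) 1)⁻¹ * Bf (E x) x) • (1 : K) := by
      rw [mul_smul, ← h2, smul_smul, inv_mul_cancel₀ hc, one_smul]
    apply hc
    rw [h3, map_smul, der_one hE]
    simp
  simp [conjK, key, der_one hE]

/-- The associator. -/
def asr (x y z : K) : K := (x * y) * z - x * (y * z)

theorem asr_add1 (x x' y z : K) : asr (x + x') y z = asr x y z + asr x' y z := by
  simp only [asr, add_mul]; abel
theorem asr_add2 (x y y' z : K) : asr x (y + y') z = asr x y z + asr x y' z := by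
  simp only [asr, add_mul, mul_add]; abel
theorem asr_add3 (x y z z' : K) : asr x y (z + z') = asr x y z + asr x y z' := by
  simp only [asr, mul_add]; abel
theorem asr_neg1 (x y z : K) : asr (-x) y z = - asr x y z := by
  simp only [asr, neg_mul, mul_neg]; abel
theorem asr_neg2 (x y z : K) : asr x (-y) z = - asr x y z := by
  simp only [asr, neg_mul, mul_neg]; abel
theorem asr_neg3 (x y z : K) : asr x y (-z) = - asr x y z := by
  simp only [asr, mul_neg]; abel
theorem asr_real1 (t : ℝ) (y z : K) : asr (t • 1) y z = 0 := by
  simp only [asr, smul_mul_assoc, mul_smul_comm, one_mul, mul_one, sub_self]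
theorem asr_real2 (t : ℝ) (y z : K) : asr y (t • 1) z = 0 := by
  simp only [asr, smul_mul_assoc, mul_smul_comm, one_mul, mul_one, sub_self]
theorem asr_real3 (t : ℝ) (y z : K) : asr y z (t • 1) = 0 := by
  simp only [asr, smul_mul_assoc, mul_smul_comm, one_mul, mul_one, sub_self]
theorem asr_conj1 (Bf : K →ₗ[ℝ] K →ₗ[ℝ] ℝ) (x y z : K) :
    asr (conjK Bf x) y z = - asr x y z := by
  rw [conjK, sub_eq_add_neg, asr_add1, asr_real1, asr_neg1, zero_add]
theorem asr_conj2 (Bf : K →ₗ[ℝ] K →ₗ[ℝ] ℝ) (x y z : K) :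
    asr x (conjK Bf y) z = - asr x y z := by
  rw [conjK, sub_eq_add_neg, asr_add2, asr_real2, asr_neg2, zero_add]
theorem asr_conj3 (Bf : K →ₗ[ℝ] K →ₗ[ℝ] ℝ) (x y z : K) :
    asr x y (conjK Bf z) = - asr x y z := by
  rw [conjK, sub_eq_add_neg, asr_add3, asr_real3, asr_neg3, zero_add]
theorem asr_alt12 {Bf : K →ₗ[ℝ] K →ₗ[ℝ] ℝ} (h : IsCompAlg Bf) (x y : K) : asr x x y = 0 := by
  simp [asr, ca_altL h]
theorem asr_alt23 {Bf : K →ₗ[ℝ] K →ₗ[ℝ] ℝ} (h : IsCompAlg Bf) (x y : K) : asr y x x = 0 := by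
  simp [asr, ca_altR h]
theorem asr_sw12 {Bf : K →ₗ[ℝ] K →ₗ[ℝ] ℝ} (h : IsCompAlg Bf) (x y z : K) :
    asr x y z = - asr y x z := by
  have := asr_alt12 h (x + y) z
  rw [asr_add1, asr_add2, asr_add2, asr_alt12 h, asr_alt12 h, zero_add, add_zero] at this
  exact eq_neg_of_add_eq_zero_left this
theorem asr_sw23 {Bf : K →ₗ[ℝ] K →ₗ[ℝ] ℝ} (h : IsCompAlg Bf) (x y z : K) :
    asr x y z = - asr x z y := by
  have := asr_alt23 h (y + z) x
  rw [asr_add2, asr_add3, asr_add3, asr_alt23 h, asr_alt23 h, zero_add, add_zero] at this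
  exact eq_neg_of_add_eq_zero_left this
/-- Cyclic invariance. -/
theorem asr_cyc {Bf : K →ₗ[ℝ] K →ₗ[ℝ] ℝ} (h : IsCompAlg Bf) (x y z : K) :
    asr x y z = asr z x y := by
  rw [asr_sw23 h, asr_sw12 h, neg_neg]

theorem ctm_mul {Bf : K →ₗ[ℝ] K →ₗ[ℝ] ℝ} (h : IsCompAlg Bf) (h1 : Bf 1 1 = 1)
    (A B : Matrix (Fin 3) (Fin 3) K) : ctm Bf (A * B) = ctm Bf B * ctm Bf A := by
  ext i j
  simp [ctm, Matrix.mul_apply, Fin.sum_univ_three, ca_conj_add, ca_conj_mul h h1]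

theorem ctm_add (Bf : K →ₗ[ℝ] K →ₗ[ℝ] ℝ)
    (A B : Matrix (Fin 3) (Fin 3) K) : ctm Bf (A + B) = ctm Bf A + ctm Bf B := by
  ext i j
  simp [ctm, ca_conj_add]

theorem ctm_sub (Bf : K →ₗ[ℝ] K →ₗ[ℝ] ℝ)
    (A B : Matrix (Fin 3) (Fin 3) K) : ctm Bf (A - B) = ctm Bf A - ctm Bf B := by
  ext i j
  simp [ctm, ca_conj_sub]

theorem ctm_map {Bf : K →ₗ[ℝ] K →ₗ[ℝ] ℝ} (h : IsCompAlg Bf) {E : K →ₗ[ℝ] K}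
    (hE : IsDerK E) (A : Matrix (Fin 3) (Fin 3) K) :
    ctm Bf (A.map E) = (ctm Bf A).map E := by
  ext i j
  simp [ctm, der_conj h hE]

theorem map_der_mul {E : K →ₗ[ℝ] K} (hE : IsDerK E) (A B : Matrix (Fin 3) (Fin 3) K) :
    (A * B).map E = A.map E * B + A * B.map E := by
  ext i j
  simp only [Matrix.map_apply, Matrix.mul_apply, Fin.sum_univ_three, map_add, hE _ _,
    Matrix.add_apply]
  abel

theorem asr_mat (A B C : Matrix (Fin 3) (Fin 3) K) (i j : Fin 3) :
    ((A * B) * C - A * (B * C)) i j = ∑ l, ∑ k, asr (A i k) (B k l) (C l j) := by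
  simp only [Matrix.sub_apply, Matrix.mul_apply, Fin.sum_univ_three, asr, mul_add, add_mul]
  abel

theorem ad_sq {Bf : K →ₗ[ℝ] K →ₗ[ℝ] ℝ} (h : IsCompAlg Bf)
    (X H : Matrix (Fin 3) (Fin 3) K) (hX : ctm Bf X = -X)
    (ht : X 0 0 + X 1 1 + X 2 2 = 0) (hH : IsHerm Bf H) :
    X * (H * H) - (H * H) * X = (X * H - H * X) * H + H * (X * H - H * X) := by
  have hXe : ∀ i j, X j i = - conjK Bf (X i j) := by
    intro i j
    have := congrFun (congrFun hX j) i
    simp only [ctm, Matrix.of_apply, Matrix.neg_apply] at this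
    rw [this, neg_neg]
  have hHe : ∀ i j, H j i = conjK Bf (H i j) := by
    intro i j
    have := congrFun (congrFun hH j) i
    simpa only [ctm, Matrix.of_apply] using this.symm
  have hd : ∀ i, H i i = Bf (H i i) 1 • (1 : K) := fun i => ca_real (hHe i i).symm
  have key : (X * H) * H - X * (H * H) - ((H * X) * H - H * (X * H))
      + ((H * H) * X - H * (H * X)) = 0 := by
    have hc : X 2 2 = - X 0 0 + - X 1 1 := by
      linear_combination (norm := module) ht
    ext i j
    rw [Matrix.add_apply, Matrix.sub_apply, asr_mat, asr_mat, asr_mat]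
    have e1 := hXe 0 1
    have e2 := hXe 1 2
    have e3 := hXe 2 0
    have f1 := hHe 0 1
    have f2 := hHe 1 2
    have f3 := hHe 2 0
    have g0 := hd 0
    have g1 := hd 1
    have g2 := hd 2
    generalize Bf (H 0 0) 1 = t0 at *
    generalize Bf (H 1 1) 1 = t1 at *
    generalize Bf (H 2 2) 1 = t2 at *
    have r1 : ∀ x u y : K, asr x u y = - asr u x y := fun x u y => asr_sw12 h _ _ _
    have r2 : ∀ x u y : K, asr x y u = asr u x y := fun x u y => asr_cyc h _ _ _
    have r3 : ∀ x u y : K, asr y u x = asr u x y := fun x u y => by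
      rw [asr_sw12 h, asr_sw23 h, neg_neg]
    have r4 : ∀ x u y : K, asr y x u = - asr u x y := fun x u y => by
      rw [asr_sw12 h, r2]
    have r5 : ∀ x u y : K, asr u y x = - asr u x y := fun x u y => asr_sw23 h _ _ _
    have r6 : ∀ x u : K, asr x u x = 0 := fun x u => by rw [r1, asr_alt23 h, neg_zero]
    obtain ⟨x, hx⟩ : ∃ w, H 0 1 = w := ⟨_, rfl⟩
    obtain ⟨y, hy⟩ : ∃ w, H 1 2 = w := ⟨_, rfl⟩
    obtain ⟨z, hz⟩ : ∃ w, H 2 0 = w := ⟨_, rfl⟩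
    obtain ⟨p, hp⟩ : ∃ w, X 0 1 = w := ⟨_, rfl⟩
    obtain ⟨q, hq⟩ : ∃ w, X 1 2 = w := ⟨_, rfl⟩
    obtain ⟨r, hr⟩ : ∃ w, X 2 0 = w := ⟨_, rfl⟩
    obtain ⟨a, ha⟩ : ∃ w, X 0 0 = w := ⟨_, rfl⟩
    obtain ⟨b, hb⟩ : ∃ w, X 1 1 = w := ⟨_, rfl⟩
    fin_cases i <;> fin_cases j <;>
    · simp only [Fin.sum_univ_three, Fin.zero_eta, Fin.mk_one, Fin.reduceFinMk, Fin.isValue,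
        hx, hy, hz, hp, hq, hr, ha, hb, e1, e2, e3, f1, f2, f3, g0, g1, g2, hc, asr_real1, asr_real2, asr_real3,
        asr_conj1, asr_conj2, asr_conj3, asr_neg1, asr_neg2, asr_neg3, asr_add1, asr_add2,
        asr_add3, asr_alt12 h, asr_alt23 h, r6 x, r6 y, r6 z,
        r1 x _ y, r2 x _ y, r3 x _ y, r4 x _ y, r5 x _ y,
        r1 x _ z, r2 x _ z, r3 x _ z, r4 x _ z, r5 x _ z,
        r1 y _ z, r2 y _ z, r3 y _ z, r4 y _ z, r5 y _ z, Matrix.zero_apply, neg_neg, neg_zero]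
      abel
  have : X * (H * H) - (H * H) * X = (X * H - H * X) * H + H * (X * H - H * X) -
    ((X * H) * H - X * (H * H) - ((H * X) * H - H * (X * H))
      + ((H * H) * X - H * (H * X))) := by
    rw [Matrix.sub_mul, Matrix.mul_sub]; abel
  rw [this, key, sub_zero]

theorem part1 {Bf : K →ₗ[ℝ] K →ₗ[ℝ] ℝ} (h : IsCompAlg Bf) (h1 : Bf 1 1 = 1)
    (X : Matrix (Fin 3) (Fin 3) K) (E : K →ₗ[ℝ] K) (hX : ctm Bf X = -X)
    (ht : X 0 0 + X 1 1 + X 2 2 = 0) (hE : IsDerK E) :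
    IsDerH3 Bf (fun H => X * H - H * X + H.map E) := by
  refine ⟨?_, ?_⟩
  · intro H hH
    have hH' : ctm Bf H = H := hH
    change ctm Bf (X * H - H * X + H.map E) = _
    rw [ctm_add, ctm_sub, ctm_mul h h1, ctm_mul h h1, ctm_map h hE, hH', hX]
    rw [Matrix.mul_neg, Matrix.neg_mul]
    abel
  · intro H L hH hL
    have hH' : ctm Bf H = H := hH
    have hL' : ctm Bf L = L := hL
    have hHL : IsHerm Bf (H + L) := by
      change ctm Bf (H + L) = _
      rw [ctm_add, hH', hL']
    have k1 := ad_sq h X (H + L) hX ht hHL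
    have k2 := ad_sq h X H hX ht hH
    have k3 := ad_sq h X L hX ht hL
    have e1 : (H * L + L * H).map E = (H * L).map E + (L * H).map E := by
      ext i j; simp
    simp only [e1, map_der_mul hE]
    simp only [Matrix.mul_add, Matrix.add_mul, Matrix.mul_sub, Matrix.sub_mul] at k1 k2 k3 ⊢
    rw [← sub_eq_zero] at k1 k2 k3 ⊢
    have : (0 : Matrix (Fin 3) (Fin 3) K) - 0 - 0 = 0 := by simp
    rw [← this]
    nth_rewrite 1 [← k1]
    nth_rewrite 1 [← k2]
    nth_rewrite 1 [← k3]
    abel_nf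

/-- The inner map `H ↦ XH - HX`. -/
def adL (X : Matrix (Fin 3) (Fin 3) K) :
    Matrix (Fin 3) (Fin 3) K →ₗ[ℝ] Matrix (Fin 3) (Fin 3) K where
  toFun H := X * H - H * X
  map_add' A B := by rw [Matrix.mul_add, Matrix.add_mul]; abel
  map_smul' t A := by
    rw [Matrix.mul_smul, Matrix.smul_mul, smul_sub]; rfl

theorem adL_apply (X H : Matrix (Fin 3) (Fin 3) K) : adL X H = X * H - H * X := rfl

theorem der_sub_ad {Bf : K →ₗ[ℝ] K →ₗ[ℝ] ℝ} (h : IsCompAlg Bf) (h1 : Bf 1 1 = 1)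
    (X : Matrix (Fin 3) (Fin 3) K) (hX : ctm Bf X = -X)
    (ht : X 0 0 + X 1 1 + X 2 2 = 0)
    {D : Matrix (Fin 3) (Fin 3) K →ₗ[ℝ] Matrix (Fin 3) (Fin 3) K}
    (hD : IsDerH3 Bf (fun H => D H)) : IsDerH3 Bf (fun H => (D - adL X) H) := by
  have hA := part1 h h1 X 0 hX ht (by intro x y; simp)
  have h0 : ∀ H : Matrix (Fin 3) (Fin 3) K, H.map (0 : K →ₗ[ℝ] K) = 0 := by
    intro H; ext; simp
  simp only [h0, add_zero] at hA
  refine ⟨?_, ?_⟩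
  · intro H hH
    have e1 := hD.1 H hH
    have e2 := hA.1 H hH
    unfold IsHerm at *
    simp only [LinearMap.sub_apply, adL_apply]
    rw [ctm_sub, e1, e2]
  · intro H L hH hL
    have e1 := hD.2 H L hH hL
    have e2 := hA.2 H L hH hL
    simp only [LinearMap.sub_apply, adL_apply] at e1 e2 ⊢
    rw [e1, e2]
    simp only [Matrix.mul_sub, Matrix.sub_mul]
    abel

/-- Diagonal real matrices. -/
def dg (a b c : ℝ) : Matrix (Fin 3) (Fin 3) K :=
  !![a • 1, 0, 0; 0, b • 1, 0; 0, 0, c • 1]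
/-- Hermitian off-diagonal matrices. -/
def od (Bf : K →ₗ[ℝ] K →ₗ[ℝ] ℝ) (x y z : K) : Matrix (Fin 3) (Fin 3) K :=
  !![0, x, z; conjK Bf x, 0, y; conjK Bf z, conjK Bf y, 0]

theorem dg_herm {Bf : K →ₗ[ℝ] K →ₗ[ℝ] ℝ} (h1 : Bf 1 1 = 1) (a b c : ℝ) :
    IsHerm Bf (dg a b c : Matrix (Fin 3) (Fin 3) K) := by
  ext i j
  fin_cases i <;> fin_cases j <;> simp [ctm, dg, ca_conj_zero, ca_conj_smul, ca_conj_one h1]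

theorem od_herm {Bf : K →ₗ[ℝ] K →ₗ[ℝ] ℝ} (h1 : Bf 1 1 = 1) (x y z : K) :
    IsHerm Bf (od Bf x y z) := by
  ext i j
  fin_cases i <;> fin_cases j <;> simp [ctm, od, ca_conj_zero, ca_conj_conj h1]

theorem herm_decomp {Bf : K →ₗ[ℝ] K →ₗ[ℝ] ℝ} {H : Matrix (Fin 3) (Fin 3) K}
    (hH : IsHerm Bf H) : ∃ a b c : ℝ, ∃ x y z : K, H = dg a b c + od Bf x y z := by
  have hHe : ∀ i j, H j i = conjK Bf (H i j) := by
    intro i j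
    have := congrFun (congrFun hH j) i
    simpa only [ctm, Matrix.of_apply] using this.symm
  have hd : ∀ i, H i i = Bf (H i i) 1 • (1 : K) := fun i => ca_real (hHe i i).symm
  refine ⟨Bf (H 0 0) 1, Bf (H 1 1) 1, Bf (H 2 2) 1, H 0 1, H 1 2, H 0 2, ?_⟩
  ext i j
  fin_cases i <;> fin_cases j <;> simp [dg, od]
  exacts [hd 0, hHe 0 1, hd 1, hHe 0 2, hHe 1 2, hd 2]

theorem half_zero {d : K} (hh : d = d + d) : d = 0 := by
  simpa using hh

theorem two_zero {d : K} (hh : d + d = 0) : d = 0 := by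
  have : (2 : ℝ) • d = 0 := by rw [two_smul, hh]
  simpa using this

theorem herm_entry {Bf : K →ₗ[ℝ] K →ₗ[ℝ] ℝ} {H : Matrix (Fin 3) (Fin 3) K}
    (hH : IsHerm Bf H) (i j : Fin 3) : H j i = conjK Bf (H i j) := by
  have := congrFun (congrFun hH j) i
  simpa only [ctm, Matrix.of_apply] using this.symm

theorem stepA {Bf : K →ₗ[ℝ] K →ₗ[ℝ] ℝ} (h : IsCompAlg Bf) (h1 : Bf 1 1 = 1)
    {D : Matrix (Fin 3) (Fin 3) K →ₗ[ℝ] Matrix (Fin 3) (Fin 3) K}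
    (hD : IsDerH3 Bf (fun H => D H)) :
    ∃ X : Matrix (Fin 3) (Fin 3) K, ctm Bf X = -X ∧ X 0 0 + X 1 1 + X 2 2 = 0 ∧
      ∀ a b c, (D - adL X) (dg a b c) = 0 := by
  obtain ⟨P, hP⟩ : ∃ P, D (dg 1 0 0) = P := ⟨_, rfl⟩
  obtain ⟨Q, hQ⟩ : ∃ P, D (dg 0 1 0) = P := ⟨_, rfl⟩
  obtain ⟨R, hR⟩ : ∃ P, D (dg 0 0 1) = P := ⟨_, rfl⟩
  have hPh := hD.1 _ (dg_herm h1 1 0 0)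
  have hQh := hD.1 _ (dg_herm h1 0 1 0)
  have hRh := hD.1 _ (dg_herm h1 0 0 1)
  have sq : ∀ a b c a' b' c' : ℝ,
      (dg a b c : Matrix (Fin 3) (Fin 3) K) * dg a' b' c' = dg (a * a') (b * b') (c * c') := by
    intro a b c a' b' c'
    ext i j
    fin_cases i <;> fin_cases j <;>
      simp [dg, Matrix.mul_apply, Fin.sum_univ_three, smul_smul, mul_comm]
  have hPP := hD.2 _ _ (dg_herm h1 1 0 0) (dg_herm h1 1 0 0)
  have hQQ := hD.2 _ _ (dg_herm h1 0 1 0) (dg_herm h1 0 1 0)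
  have hRR := hD.2 _ _ (dg_herm h1 0 0 1) (dg_herm h1 0 0 1)
  have hPQ := hD.2 _ _ (dg_herm h1 1 0 0) (dg_herm h1 0 1 0)
  have hQR := hD.2 _ _ (dg_herm h1 0 1 0) (dg_herm h1 0 0 1)
  have hPR := hD.2 _ _ (dg_herm h1 1 0 0) (dg_herm h1 0 0 1)
  have z0 : (dg 0 0 0 : Matrix (Fin 3) (Fin 3) K) = 0 := by
    ext i j
    fin_cases i <;> fin_cases j <;> simp [dg]
  simp only [sq, mul_zero, zero_mul, mul_one, z0, map_zero, add_zero, map_add, hP, hQ, hR]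
    at hPP hQQ hRR hPQ hQR hPR hPh hQh hRh
  have ent : ∀ {A B : Matrix (Fin 3) (Fin 3) K}, A = B → ∀ i j, A i j = B i j := by
    intro A B hh i j; rw [hh]
  have pp := ent hPP
  have qq := ent hQQ
  have rr := ent hRR
  have pq := ent hPQ
  have qr := ent hQR
  have pr := ent hPR
  simp only [Matrix.add_apply, Matrix.mul_apply, Fin.sum_univ_three, Matrix.zero_apply]
    at pp qq rr pq qr pr
  have sp : ∀ (i j : Fin 3), i = j ∨ (i ≠ 0 ∧ j ≠ 0) → P i j = 0 := by
    intro i j hij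
    have := pp i j
    fin_cases i <;> fin_cases j <;> simp [dg] at hij this ⊢ <;>
    first | exact this | exact two_zero this
  have sq' : ∀ (i j : Fin 3), i = j ∨ (i ≠ 1 ∧ j ≠ 1) → Q i j = 0 := by
    intro i j hij
    have := qq i j
    fin_cases i <;> fin_cases j <;> simp [dg] at hij this ⊢ <;>
    first | exact this | exact two_zero this
  have sr : ∀ (i j : Fin 3), i = j ∨ (i ≠ 2 ∧ j ≠ 2) → R i j = 0 := by
    intro i j hij
    have := rr i j
    fin_cases i <;> fin_cases j <;> simp [dg] at hij this ⊢ <;>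
    first | exact this | exact two_zero this
  have t1 := pq 0 1
  have t2 := qr 1 2
  have t3 := pr 0 2
  have t1' := pq 1 0
  have t2' := qr 2 1
  have t3' := pr 2 0
  simp [dg] at t1 t2 t3 t1' t2' t3'
  have w1 : Q 0 1 = - P 0 1 := by rw [eq_neg_iff_add_eq_zero, add_comm]; exact t1.symm
  have w2 : R 1 2 = - Q 1 2 := by rw [eq_neg_iff_add_eq_zero, add_comm]; exact t2.symm
  have w3 : R 0 2 = - P 0 2 := by rw [eq_neg_iff_add_eq_zero, add_comm]; exact t3.symm
  have v1 := herm_entry hPh 0 1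
  have v2 := herm_entry hQh 1 2
  have v3 := herm_entry hPh 0 2
  have v1' := herm_entry hQh 0 1
  have v2' := herm_entry hRh 1 2
  have v3' := herm_entry hRh 0 2
  refine ⟨!![0, Q 0 1, R 0 2; P 1 0, 0, R 1 2; P 2 0, Q 2 1, 0], ?_, by simp, ?_⟩
  · ext i j
    fin_cases i <;> fin_cases j <;>
      simp [ctm, ca_conj_zero, w1, w2, w3, v1, v2, v3, ca_conj_neg, ca_conj_conj h1]
  · intro a b c
    have : (dg a b c : Matrix (Fin 3) (Fin 3) K) = a • dg 1 0 0 + b • dg 0 1 0 + c • dg 0 0 1 := by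
      ext i j
      fin_cases i <;> fin_cases j <;> simp [dg]
    rw [LinearMap.sub_apply, adL_apply]
    nth_rewrite 1 [this]
    simp only [map_add, map_smul, hP, hQ, hR]
    ext i j
    fin_cases i <;> fin_cases j <;>
      simp [dg, Matrix.mul_apply, Fin.sum_univ_three, sp, sq', sr, w1, w2, w3, v1, v2, v3,
        v1', v2', v3', ca_conj_neg]
    all_goals abel

theorem od_add (Bf : K →ₗ[ℝ] K →ₗ[ℝ] ℝ) (x y z x' y' z' : K) :
    od Bf (x + x') (y + y') (z + z') = od Bf x y z + od Bf x' y' z' := by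
  ext i j
  fin_cases i <;> fin_cases j <;> simp [od, ca_conj_add]

theorem od_smul (Bf : K →ₗ[ℝ] K →ₗ[ℝ] ℝ) (t : ℝ) (x y z : K) :
    od Bf (t • x) (t • y) (t • z) = t • od Bf x y z := by
  ext i j
  fin_cases i <;> fin_cases j <;> simp [od, ca_conj_smul]

/-- Off-diagonal matrices depend linearly on their entries. -/
def odL (Bf : K →ₗ[ℝ] K →ₗ[ℝ] ℝ) : K × K × K →ₗ[ℝ] Matrix (Fin 3) (Fin 3) K where
  toFun p := od Bf p.1 p.2.1 p.2.2
  map_add' p q := od_add Bf _ _ _ _ _ _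
  map_smul' t p := od_smul Bf t _ _ _

/-- A matrix entry as a linear map. -/
def entL (i j : Fin 3) : Matrix (Fin 3) (Fin 3) K →ₗ[ℝ] K where
  toFun M := M i j
  map_add' _ _ := rfl
  map_smul' _ _ := rfl

theorem offdiag {Bf : K →ₗ[ℝ] K →ₗ[ℝ] ℝ} (h1 : Bf 1 1 = 1)
    {D : Matrix (Fin 3) (Fin 3) K →ₗ[ℝ] Matrix (Fin 3) (Fin 3) K}
    (hD : IsDerH3 Bf (fun H => D H)) (h0 : ∀ a b c, D (dg a b c) = 0) :
    ∃ T1 T2 T3 : K →ₗ[ℝ] K, ∀ x y z, D (od Bf x y z) = od Bf (T1 x) (T2 y) (T3 z) := by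
  have key : ∀ a b c : ℝ, ∀ H, IsHerm Bf H →
      D (dg a b c * H + H * dg a b c) = dg a b c * D H + D H * dg a b c := by
    intro a b c H hH
    have := hD.2 _ _ (dg_herm h1 a b c) hH
    simpa [h0] using this
  have k1 : ∀ x, D (od Bf x 0 0) = od Bf (D (od Bf x 0 0) 0 1) 0 0 := by
    intro x
    have e1 := key 1 1 0 _ (od_herm h1 x 0 0)
    have e2 := key 1 0 0 _ (od_herm h1 x 0 0)
    have f1 : dg 1 1 0 * od Bf x 0 0 + od Bf x 0 0 * dg 1 1 0
      = od Bf x 0 0 + od Bf x 0 0 := by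
      ext i j
      fin_cases i <;> fin_cases j <;>
        simp [od, dg, Matrix.mul_apply, Fin.sum_univ_three, ca_conj_zero]
    have f2 : dg 1 0 0 * od Bf x 0 0 + od Bf x 0 0 * dg 1 0 0 = od Bf x 0 0 := by
      ext i j
      fin_cases i <;> fin_cases j <;>
        simp [od, dg, Matrix.mul_apply, Fin.sum_univ_three, ca_conj_zero]
    rw [f1, map_add] at e1
    rw [f2] at e2
    have hM := hD.1 _ (od_herm h1 x 0 0)
    simp only at hM
    generalize D (od Bf x 0 0) = M at *
    have hc := herm_entry hM 0 1
    ext i j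
    have e1' := congrFun (congrFun e1 i) j
    have e2' := congrFun (congrFun e2 i) j
    simp only [Matrix.add_apply, Matrix.mul_apply, Fin.sum_univ_three] at e1' e2'
    fin_cases i <;> fin_cases j <;>
      simp [od, dg, Matrix.mul_apply, Fin.sum_univ_three, ca_conj_zero] at e1' e2' ⊢ <;>
      first | exact e1' | exact e2' | exact hc | exact two_zero e1' |
        (rw [e2'] at e1'; simpa using e1')
  have k2 : ∀ x, D (od Bf 0 x 0) = od Bf 0 (D (od Bf 0 x 0) 1 2) 0 := by
    intro x
    have e1 := key 0 1 1 _ (od_herm h1 0 x 0)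
    have e2 := key 0 1 0 _ (od_herm h1 0 x 0)
    have f1 : dg 0 1 1 * od Bf 0 x 0 + od Bf 0 x 0 * dg 0 1 1
      = od Bf 0 x 0 + od Bf 0 x 0 := by
      ext i j
      fin_cases i <;> fin_cases j <;>
        simp [od, dg, Matrix.mul_apply, Fin.sum_univ_three, ca_conj_zero]
    have f2 : dg 0 1 0 * od Bf 0 x 0 + od Bf 0 x 0 * dg 0 1 0 = od Bf 0 x 0 := by
      ext i j
      fin_cases i <;> fin_cases j <;>
        simp [od, dg, Matrix.mul_apply, Fin.sum_univ_three, ca_conj_zero]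
    rw [f1, map_add] at e1
    rw [f2] at e2
    have hM := hD.1 _ (od_herm h1 0 x 0)
    simp only at hM
    generalize D (od Bf 0 x 0) = M at *
    have hc := herm_entry hM 1 2
    ext i j
    have e1' := congrFun (congrFun e1 i) j
    have e2' := congrFun (congrFun e2 i) j
    simp only [Matrix.add_apply, Matrix.mul_apply, Fin.sum_univ_three] at e1' e2'
    fin_cases i <;> fin_cases j <;>
      simp [od, dg, Matrix.mul_apply, Fin.sum_univ_three, ca_conj_zero] at e1' e2' ⊢ <;>
      first | exact e1' | exact e2' | exact hc | exact two_zero e1' |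
        (rw [e2'] at e1'; simpa using e1')
  have k3 : ∀ x, D (od Bf 0 0 x) = od Bf 0 0 (D (od Bf 0 0 x) 0 2) := by
    intro x
    have e1 := key 1 0 1 _ (od_herm h1 0 0 x)
    have e2 := key 1 0 0 _ (od_herm h1 0 0 x)
    have f1 : dg 1 0 1 * od Bf 0 0 x + od Bf 0 0 x * dg 1 0 1
      = od Bf 0 0 x + od Bf 0 0 x := by
      ext i j
      fin_cases i <;> fin_cases j <;>
        simp [od, dg, Matrix.mul_apply, Fin.sum_univ_three, ca_conj_zero]
    have f2 : dg 1 0 0 * od Bf 0 0 x + od Bf 0 0 x * dg 1 0 0 = od Bf 0 0 x := by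
      ext i j
      fin_cases i <;> fin_cases j <;>
        simp [od, dg, Matrix.mul_apply, Fin.sum_univ_three, ca_conj_zero]
    rw [f1, map_add] at e1
    rw [f2] at e2
    have hM := hD.1 _ (od_herm h1 0 0 x)
    simp only at hM
    generalize D (od Bf 0 0 x) = M at *
    have hc := herm_entry hM 0 2
    ext i j
    have e1' := congrFun (congrFun e1 i) j
    have e2' := congrFun (congrFun e2 i) j
    simp only [Matrix.add_apply, Matrix.mul_apply, Fin.sum_univ_three] at e1' e2'
    fin_cases i <;> fin_cases j <;>
      simp [od, dg, Matrix.mul_apply, Fin.sum_univ_three, ca_conj_zero] at e1' e2' ⊢ <;>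
      first | exact e1' | exact e2' | exact hc | exact two_zero e1' |
        (rw [e2'] at e1'; simpa using e1')
  refine ⟨entL 0 1 ∘ₗ D ∘ₗ odL Bf ∘ₗ LinearMap.inl ℝ K (K × K),
    entL 1 2 ∘ₗ D ∘ₗ odL Bf ∘ₗ LinearMap.inr ℝ K (K × K) ∘ₗ LinearMap.inl ℝ K K,
    entL 0 2 ∘ₗ D ∘ₗ odL Bf ∘ₗ LinearMap.inr ℝ K (K × K) ∘ₗ LinearMap.inr ℝ K K, ?_⟩
  intro x y z
  change _ = od Bf (D (od Bf x 0 0) 0 1) (D (od Bf 0 y 0) 1 2) (D (od Bf 0 0 z) 0 2)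
  have s : ∀ u v w : K, od Bf u v w = od Bf u 0 0 + od Bf 0 v 0 + od Bf 0 0 w := by
    intro u v w
    rw [← od_add, ← od_add]; simp
  rw [s (D (od Bf x 0 0) 0 1), ← k1, ← k2, ← k3, ← map_add, ← map_add, ← s]

theorem tri {Bf : K →ₗ[ℝ] K →ₗ[ℝ] ℝ} (h : IsCompAlg Bf) (h1 : Bf 1 1 = 1)
    {D : Matrix (Fin 3) (Fin 3) K →ₗ[ℝ] Matrix (Fin 3) (Fin 3) K}
    (hD : IsDerH3 Bf (fun H => D H)) {T1 T2 T3 : K →ₗ[ℝ] K}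
    (hT : ∀ x y z, D (od Bf x y z) = od Bf (T1 x) (T2 y) (T3 z)) (x y : K) :
    T3 (x * y) = T1 x * y + x * T2 y := by
  have e := hD.2 _ _ (od_herm h1 x 0 0) (od_herm h1 0 y 0)
  have f : od Bf x 0 0 * od Bf 0 y 0 + od Bf 0 y 0 * od Bf x 0 0 = od Bf 0 0 (x * y) := by
    ext i j
    fin_cases i <;> fin_cases j <;>
      simp [od, Matrix.mul_apply, Fin.sum_univ_three, ca_conj_zero, ca_conj_mul h h1]
  simp only [f, hT, map_zero] at e
  have e' := congrFun (congrFun e 0) 2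
  simpa [od, Matrix.mul_apply, Fin.sum_univ_three, ca_conj_zero] using e'

theorem imag1 {Bf : K →ₗ[ℝ] K →ₗ[ℝ] ℝ} (h1 : Bf 1 1 = 1)
    {D : Matrix (Fin 3) (Fin 3) K →ₗ[ℝ] Matrix (Fin 3) (Fin 3) K}
    (hD : IsDerH3 Bf (fun H => D H)) (h0 : ∀ a b c, D (dg a b c) = 0) {T1 T2 T3 : K →ₗ[ℝ] K}
    (hT : ∀ x y z, D (od Bf x y z) = od Bf (T1 x) (T2 y) (T3 z)) :
    conjK Bf (T1 1) = - T1 1 := by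
  have e := hD.2 _ _ (od_herm h1 1 0 0) (od_herm h1 1 0 0)
  have f : od Bf 1 0 0 * od Bf 1 0 0 + od Bf 1 0 0 * od Bf 1 0 0 = dg 2 2 0 := by
    ext i j
    fin_cases i <;> fin_cases j <;>
      simp [od, dg, Matrix.mul_apply, Fin.sum_univ_three, ca_conj_zero, ca_conj_one h1, two_smul]
  simp only [f, hT, map_zero, h0] at e
  have e' := congrFun (congrFun e 0) 0
  simp [od, Matrix.mul_apply, Fin.sum_univ_three, ca_conj_zero, ca_conj_one h1] at e'
  rw [eq_neg_iff_add_eq_zero]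
  apply two_zero
  rw [e']; abel

theorem imag2 {Bf : K →ₗ[ℝ] K →ₗ[ℝ] ℝ} (h1 : Bf 1 1 = 1)
    {D : Matrix (Fin 3) (Fin 3) K →ₗ[ℝ] Matrix (Fin 3) (Fin 3) K}
    (hD : IsDerH3 Bf (fun H => D H)) (h0 : ∀ a b c, D (dg a b c) = 0) {T1 T2 T3 : K →ₗ[ℝ] K}
    (hT : ∀ x y z, D (od Bf x y z) = od Bf (T1 x) (T2 y) (T3 z)) :
    conjK Bf (T2 1) = - T2 1 := by
  have e := hD.2 _ _ (od_herm h1 0 1 0) (od_herm h1 0 1 0)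
  have f : od Bf 0 1 0 * od Bf 0 1 0 + od Bf 0 1 0 * od Bf 0 1 0 = dg 0 2 2 := by
    ext i j
    fin_cases i <;> fin_cases j <;>
      simp [od, dg, Matrix.mul_apply, Fin.sum_univ_three, ca_conj_zero, ca_conj_one h1, two_smul]
  simp only [f, hT, map_zero, h0] at e
  have e' := congrFun (congrFun e 1) 1
  simp [od, Matrix.mul_apply, Fin.sum_univ_three, ca_conj_zero, ca_conj_one h1] at e'
  rw [eq_neg_iff_add_eq_zero]
  apply two_zero
  rw [e']; abel

theorem stepB {Bf : K →ₗ[ℝ] K →ₗ[ℝ] ℝ} (h : IsCompAlg Bf) (h1 : Bf 1 1 = 1)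
    {D : Matrix (Fin 3) (Fin 3) K →ₗ[ℝ] Matrix (Fin 3) (Fin 3) K}
    (hD : IsDerH3 Bf (fun H => D H)) (h0 : ∀ a b c, D (dg a b c) = 0) :
    ∃ X : Matrix (Fin 3) (Fin 3) K, ctm Bf X = -X ∧ X 0 0 + X 1 1 + X 2 2 = 0 ∧
      ∃ E : K →ₗ[ℝ] K, IsDerK E ∧ ∀ H, IsHerm Bf H → (D - adL X) H = H.map E := by
  obtain ⟨T1, T2, T3, hT⟩ := offdiag h1 hD h0
  have i1 := imag1 h1 hD h0 hT
  have i2 := imag2 h1 hD h0 hT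
  obtain ⟨u, hu⟩ : ∃ u, T1 1 = u := ⟨_, rfl⟩
  obtain ⟨v, hv⟩ : ∃ v, T2 1 = v := ⟨_, rfl⟩
  rw [hu] at i1
  rw [hv] at i2
  obtain ⟨X, hXd⟩ : ∃ X : Matrix (Fin 3) (Fin 3) K,
    X = !![(2 / 3 : ℝ) • u + (1 / 3 : ℝ) • v, 0, 0; 0, (1 / 3 : ℝ) • v - (1 / 3 : ℝ) • u, 0;
      0, 0, - (1 / 3 : ℝ) • u - (2 / 3 : ℝ) • v] := ⟨_, rfl⟩
  have hX : ctm Bf X = -X := by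
    ext i j
    fin_cases i <;> fin_cases j <;>
      simp only [hXd, ctm, ca_conj_zero, ca_conj_add, ca_conj_smul, ca_conj_sub, i1, i2,
        Matrix.of_apply, Matrix.neg_apply] <;>
      simp [ca_conj_zero, ca_conj_add, ca_conj_smul, ca_conj_sub, ca_conj_neg, i1, i2] <;> module
  have ht : X 0 0 + X 1 1 + X 2 2 = 0 := by
    simp [hXd]; module
  have hD' := der_sub_ad h h1 X hX ht hD
  have h0' : ∀ a b c, (D - adL X) (dg a b c) = 0 := by
    intro a b c
    rw [LinearMap.sub_apply, adL_apply, h0, hXd]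
    ext i j
    fin_cases i <;> fin_cases j <;>
      simp [dg, Matrix.mul_apply, Fin.sum_univ_three]
  obtain ⟨S1, S2, S3, hS⟩ := offdiag h1 hD' h0'
  have s1 : S1 1 = 0 := by
    have := congrFun (congrFun (hS 1 0 0) 0) 1
    rw [LinearMap.sub_apply, adL_apply, hT, hu, hXd] at this
    simp [od, Matrix.mul_apply, Fin.sum_univ_three] at this
    rw [← this]; module
  have s2 : S2 1 = 0 := by
    have := congrFun (congrFun (hS 0 1 0) 1) 2
    rw [LinearMap.sub_apply, adL_apply, hT, hv, hXd] at this
    simp [od, Matrix.mul_apply, Fin.sum_univ_three] at this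
    rw [← this]; module
  have hS' := tri h h1 hD' hS
  have e3 : ∀ x, S3 x = S1 x := by
    intro x
    have := hS' x 1
    simpa [s2] using this
  have e2 : ∀ x, S2 x = S1 x := by
    intro x
    have := hS' 1 x
    rw [← e3]
    simpa [s1] using this.symm
  have hE : IsDerK S1 := by
    intro x y
    have := hS' x y
    rwa [e3, e2] at this
  refine ⟨X, hX, ht, S1, hE, ?_⟩
  intro H hH
  obtain ⟨a, b, c, x, y, z, rfl⟩ := herm_decomp hH
  rw [map_add, h0', hS, zero_add]
  ext i j
  fin_cases i <;> fin_cases j <;>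
    simp [od, dg, e2, e3, der_conj h hE, s1]

theorem uniq {Bf : K →ₗ[ℝ] K →ₗ[ℝ] ℝ} (h1 : Bf 1 1 = 1)
    {X : Matrix (Fin 3) (Fin 3) K} {E F : K →ₗ[ℝ] K}
    (hE : IsDerK E) (hF : IsDerK F) (ht : X 0 0 + X 1 1 + X 2 2 = 0)
    (hh : ∀ H, IsHerm Bf H → X * H - H * X + H.map E - H.map F = 0) : X = 0 ∧ E = F := by
  have a1 : ∀ i j, _ := fun i j => congrFun (congrFun (hh _ (dg_herm h1 1 0 0)) i) j
  have a2 : ∀ i j, _ := fun i j => congrFun (congrFun (hh _ (dg_herm h1 0 1 0)) i) j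
  have b : ∀ x, _ := fun x => congrFun (congrFun (hh _ (od_herm h1 x 0 0)) 0) 1
  have c : ∀ x, _ := fun x => congrFun (congrFun (hh _ (od_herm h1 0 x 0)) 1) 2
  have p1 := a1 0 1
  have p2 := a1 0 2
  have p3 := a1 1 0
  have p4 := a1 2 0
  have p5 := a2 1 2
  have p6 := a2 2 1
  have q1 := b 1
  have q2 := c 1
  simp only [Matrix.add_apply, Matrix.sub_apply, Matrix.mul_apply, Fin.sum_univ_three]
    at p1 p2 p3 p4 p5 p6 q1 q2
  simp [dg, od, ca_conj_zero, der_one hE, der_one hF] at p1 p2 p3 p4 p5 p6 q1 q2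
  have r1 : X 0 0 = X 1 1 := by
    rw [← sub_eq_zero]; exact q1
  have r2 : X 1 1 = X 2 2 := by
    rw [← sub_eq_zero]; exact q2
  have r3 : X 2 2 = 0 := by
    rw [r1, r2] at ht
    have : (3 : ℝ) • X 2 2 = 0 := by
      rw [← ht]; module
    simpa using this
  have r2' := r2.trans r3
  have r1' := r1.trans r2'
  have hX : X = 0 := by
    ext i j
    fin_cases i <;> fin_cases j <;> simp <;> assumption
  refine ⟨hX, ?_⟩
  ext x
  have := b x
  rw [hX] at this
  simp [od] at this
  exact sub_eq_zero.1 this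

theorem part2 {Bf : K →ₗ[ℝ] K →ₗ[ℝ] ℝ} (h : IsCompAlg Bf) (h1 : Bf 1 1 = 1)
    (D : Matrix (Fin 3) (Fin 3) K →ₗ[ℝ] Matrix (Fin 3) (Fin 3) K)
    (hD : IsDerH3 Bf (fun H => D H)) :
    ∃! p : Matrix (Fin 3) (Fin 3) K × (K →ₗ[ℝ] K),
      (ctm Bf p.1 = -p.1 ∧ p.1 0 0 + p.1 1 1 + p.1 2 2 = 0 ∧ IsDerK p.2) ∧
      ∀ H, IsHerm Bf H → D H = p.1 * H - H * p.1 + H.map p.2 := by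
  obtain ⟨X, hX, hXt, hX0⟩ := stepA h h1 hD
  obtain ⟨Y, hY, hYt, E, hE, hH⟩ := stepB h h1 (der_sub_ad h h1 X hX hXt hD) hX0
  have ht : (X + Y) 0 0 + (X + Y) 1 1 + (X + Y) 2 2 = 0 := by
    have : (X + Y) 0 0 + (X + Y) 1 1 + (X + Y) 2 2 =
      (X 0 0 + X 1 1 + X 2 2) + (Y 0 0 + Y 1 1 + Y 2 2) := by
      simp only [Matrix.add_apply]; abel
    rw [this, hXt, hYt, add_zero]
  have hrep : ∀ H, IsHerm Bf H → D H = (X + Y) * H - H * (X + Y) + H.map E := by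
    intro H hHh
    have := hH H hHh
    simp only [LinearMap.sub_apply, adL_apply] at this
    rw [← this, Matrix.add_mul, Matrix.mul_add]; abel
  refine ⟨(X + Y, E), ⟨⟨?_, ht, hE⟩, hrep⟩, ?_⟩
  · change ctm Bf (X + Y) = -(X + Y)
    rw [ctm_add, hX, hY, neg_add]
  · rintro ⟨Z, F⟩ ⟨⟨hZ, hZt, hF⟩, hZF⟩
    simp only at hZ hZt hF hZF
    have := uniq (Bf := Bf) (X := Z - (X + Y)) h1 hF hE (by
      have : (Z - (X + Y)) 0 0 + (Z - (X + Y)) 1 1 + (Z - (X + Y)) 2 2 =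
        (Z 0 0 + Z 1 1 + Z 2 2) - ((X + Y) 0 0 + (X + Y) 1 1 + (X + Y) 2 2) := by
        simp only [Matrix.sub_apply]; abel
      rw [this, hZt, ht, sub_zero]) (by
      intro H hHh
      have e1 := hZF H hHh
      have e2 := hrep H hHh
      have e3 : D H - D H = 0 := sub_self _
      nth_rewrite 1 [e1] at e3
      rw [e2] at e3
      rw [← e3]
      simp only [Matrix.sub_mul, Matrix.mul_sub]
      abel)
    ext1
    · exact sub_eq_zero.1 this.1
    · exact this.2

end Aux

/-- `Der H₃(K) = Der K ∔ A₃′(K)`: for every traceless antihermitian `X` and every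
derivation `E` of `K`, the map `H ↦ XH - HX + Ê(H)` (with `Ê` acting entrywise) is a
derivation of `H₃(K)`; conversely, every derivation of `H₃(K)` agrees on hermitian
matrices with such a map, for a unique pair `(X, E)`. -/
theorem statement9 [FiniteDimensional ℝ K]
    (Bf : K →ₗ[ℝ] K →ₗ[ℝ] ℝ) (hca : IsCompAlg Bf) :
    (∀ (X : Matrix (Fin 3) (Fin 3) K) (E : K →ₗ[ℝ] K),
        ctm Bf X = -X → X 0 0 + X 1 1 + X 2 2 = 0 → IsDerK E →
        IsDerH3 Bf (fun H => X * H - H * X + H.map E))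
    ∧ (∀ D : Matrix (Fin 3) (Fin 3) K →ₗ[ℝ] Matrix (Fin 3) (Fin 3) K,
        IsDerH3 Bf (fun H => D H) →
        ∃! p : Matrix (Fin 3) (Fin 3) K × (K →ₗ[ℝ] K),
          (ctm Bf p.1 = -p.1 ∧ p.1 0 0 + p.1 1 1 + p.1 2 2 = 0 ∧ IsDerK p.2) ∧
          ∀ H, IsHerm Bf H → D H = p.1 * H - H * p.1 + H.map p.2) := by
  rcases ca_one hca with h1 | h0
  · exact ⟨fun X E hX ht hE => part1 hca h1 X E hX ht hE, fun D hD => part2 hca h1 D hD⟩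
  · have hs : Subsingleton K := ⟨fun x y => by rw [h0 x, h0 y]⟩
    have hm : ∀ A B : Matrix (Fin 3) (Fin 3) K, A = B := by
      intro A B; ext i j; exact Subsingleton.elim _ _
    refine ⟨fun X E _ _ _ => ⟨fun _ _ => hm _ _, fun _ _ _ _ => hm _ _⟩, fun D _ => ?_⟩
    refine ⟨(0, 0), ⟨⟨hm _ _, Subsingleton.elim _ _, fun _ _ => Subsingleton.elim _ _⟩,
      fun _ _ => hm _ _⟩, ?_⟩
    rintro ⟨Z, F⟩ _
    ext1
    · exact hm _ _
    · ext x; exact Subsingleton.elim _ _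
end
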